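/- arXiv:2408.03169 — 2 statements merged into one kernel-verified Lean document; each statement's English description precedes it below -/
import Mathlib

section
/- Let X be a topological space and let A and B be subsets of X. If A is a-open and B is e-open, then A ∩ B is e-open. -/
open Set Topology

/-- A set is regular open if it equals the interior of its closure. -/
def RegOpen {X : Type*} [TopologicalSpace X] (U : Set X) : Prop :=
  U = interior (closure U)

/-- The δ-interior of `A`: the union of all regular open sets contained in `A`. -/
def deltaInt {X : Type*} [TopologicalSpace X] (A : Set X) : Set X :=
  ⋃₀ {U : Set X | RegOpen U ∧ U ⊆ A}

/-- The δ-closure of `A`: the complement of the δ-interior of the complement. -/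
def deltaCl {X : Type*} [TopologicalSpace X] (A : Set X) : Set X :=
  (deltaInt Aᶜ)ᶜ

/-- `A` is a-open if `A ⊆ int(cl(δ-int A))`. -/
def AOpen {X : Type*} [TopologicalSpace X] (A : Set X) : Prop :=
  A ⊆ interior (closure (deltaInt A))

/-- `A` is a-closed if its complement is a-open. -/
def AClosed {X : Type*} [TopologicalSpace X] (A : Set X) : Prop :=
  AOpen Aᶜ

/-- `A` is a-locally closed if it is the intersection of an a-open and an a-closed set. -/
def ALocallyClosed {X : Type*} [TopologicalSpace X] (A : Set X) : Prop :=
  ∃ U V : Set X, AOpen U ∧ AClosed V ∧ A = U ∩ V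

/-- `A` is e-open if `A ⊆ cl(δ-int A) ∪ int(δ-cl A)`. -/
def EOpen {X : Type*} [TopologicalSpace X] (A : Set X) : Prop :=
  A ⊆ closure (deltaInt A) ∪ interior (deltaCl A)

/-- `A` is e-closed if its complement is e-open. -/
def EClosed {X : Type*} [TopologicalSpace X] (A : Set X) : Prop :=
  EOpen Aᶜ

/-- `A` is e-locally closed if it is the intersection of an e-open and an e-closed set. -/
def ELocallyClosed {X : Type*} [TopologicalSpace X] (A : Set X) : Prop :=
  ∃ U V : Set X, EOpen U ∧ EClosed V ∧ A = U ∩ V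

/-- The a-closure of `A`: the intersection of all a-closed supersets of `A`. -/
def aCl {X : Type*} [TopologicalSpace X] (A : Set X) : Set X :=
  ⋂₀ {F : Set X | AClosed F ∧ A ⊆ F}

/-- The a-interior of `A`: the union of all a-open subsets of `A`. -/
def aInt {X : Type*} [TopologicalSpace X] (A : Set X) : Set X :=
  ⋃₀ {U : Set X | AOpen U ∧ U ⊆ A}

/-- The e-closure of `A`: the intersection of all e-closed supersets of `A`. -/
def eCl {X : Type*} [TopologicalSpace X] (A : Set X) : Set X :=
  ⋂₀ {F : Set X | EClosed F ∧ A ⊆ F}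

/-- `S` is semi-open if `S ⊆ cl(int S)`. -/
def SemiOpen {X : Type*} [TopologicalSpace X] (S : Set X) : Prop :=
  S ⊆ closure (interior S)

/-- `S` is semi-closed if its complement is semi-open. -/
def SemiClosed {X : Type*} [TopologicalSpace X] (S : Set X) : Prop :=
  SemiOpen Sᶜ

/-- The semi-closure of `U`: the intersection of all semi-closed supersets of `U`. -/
def sCl {X : Type*} [TopologicalSpace X] (U : Set X) : Set X :=
  ⋂₀ {F : Set X | SemiClosed F ∧ U ⊆ F}

/-- `A` is feebly open if there is an open `U` with `U ⊆ A ⊆ scl(U)`. -/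
def FeeblyOpen {X : Type*} [TopologicalSpace X] (A : Set X) : Prop :=
  ∃ U : Set X, IsOpen U ∧ U ⊆ A ∧ A ⊆ sCl U

/-- `A` is feebly closed if its complement is feebly open. -/
def FeeblyClosed {X : Type*} [TopologicalSpace X] (A : Set X) : Prop :=
  FeeblyOpen Aᶜ

/-- `A` is feebly locally closed if it is the intersection of a feebly open and a
feebly closed set. -/
def FeeblyLocallyClosed {X : Type*} [TopologicalSpace X] (A : Set X) : Prop :=
  ∃ U V : Set X, FeeblyOpen U ∧ FeeblyClosed V ∧ A = U ∩ V

/-- `A` is α-open if `A ⊆ int(cl(int A))`. -/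
def AlphaOpen {X : Type*} [TopologicalSpace X] (A : Set X) : Prop :=
  A ⊆ interior (closure (interior A))

/-- `A` is α-closed if its complement is α-open. -/
def AlphaClosed {X : Type*} [TopologicalSpace X] (A : Set X) : Prop :=
  AlphaOpen Aᶜ

/-- `A` is α-locally closed if it is the intersection of an α-open and an α-closed set. -/
def AlphaLocallyClosed {X : Type*} [TopologicalSpace X] (A : Set X) : Prop :=
  ∃ U V : Set X, AlphaOpen U ∧ AlphaClosed V ∧ A = U ∩ V

/-- `X` is submaximal if every dense subset of `X` is open. -/
def Submaximal (X : Type*) [TopologicalSpace X] : Prop :=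
  ∀ A : Set X, closure A = univ → IsOpen A

/-- `X` is a-submaximal if every a-dense subset of `X` is a-open. -/
def ASubmaximal (X : Type*) [TopologicalSpace X] : Prop :=
  ∀ A : Set X, aCl A = univ → AOpen A

/-- `X` is e-submaximal if every e-dense subset of `X` is e-open. -/
def ESubmaximal (X : Type*) [TopologicalSpace X] : Prop :=
  ∀ A : Set X, eCl A = univ → EOpen A

/-- `X` is an e-space if a subset is open precisely when it is e-open. -/
def IsESpace (X : Type*) [TopologicalSpace X] : Prop :=
  ∀ A : Set X, IsOpen A ↔ EOpen A

theorem RegOpen.isOpen_aux {X : Type*} [TopologicalSpace X] {U : Set X} (h : RegOpen U) :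
    IsOpen U := by
  unfold RegOpen at h
  rw [h]
  exact isOpen_interior

theorem RegOpen.inter_aux {X : Type*} [TopologicalSpace X] {U V : Set X}
    (hU : RegOpen U) (hV : RegOpen V) : RegOpen (U ∩ V) := by
  apply Subset.antisymm
  · exact interior_maximal subset_closure (hU.isOpen_aux.inter hV.isOpen_aux)
  · intro x hx
    refine ⟨?_, ?_⟩
    · unfold RegOpen at hU
      rw [hU]
      exact interior_mono (closure_mono inter_subset_left) hx
    · unfold RegOpen at hV
      rw [hV]
      exact interior_mono (closure_mono inter_subset_right) hx

theorem isOpen_deltaInt_aux {X : Type*} [TopologicalSpace X] (A : Set X) :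
    IsOpen (deltaInt A) :=
  isOpen_sUnion fun _ h => h.1.isOpen_aux

theorem mem_deltaCl_aux {X : Type*} [TopologicalSpace X] (A : Set X) (x : X) :
    x ∈ deltaCl A ↔ ∀ U, RegOpen U → x ∈ U → (U ∩ A).Nonempty := by
  constructor
  · intro h U hU hx
    by_contra hne
    exact h ⟨U, ⟨hU, fun y hy hyA => hne ⟨y, hy, hyA⟩⟩, hx⟩
  · rintro h ⟨U, ⟨hU, hUA⟩, hx⟩
    obtain ⟨y, hy, hyA⟩ := h U hU hx
    exact hUA hy hyA

theorem aOpen_inter_eOpen {X : Type*} [TopologicalSpace X] (A B : Set X)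
    (hA : AOpen A) (hB : EOpen B) : EOpen (A ∩ B) := by
  rintro x ⟨hxA, hxB⟩
  have hW := hA hxA
  rcases hB hxB with h | h
  · left
    rw [mem_closure_iff] at h ⊢
    intro V hV hxV
    obtain ⟨y, ⟨hyV, hyW⟩, hyB⟩ := h _ (hV.inter isOpen_interior) ⟨hxV, hW⟩
    obtain ⟨z, ⟨hzV, hzB⟩, hzA⟩ := mem_closure_iff.1 (interior_subset hyW) _
      (hV.inter (isOpen_deltaInt_aux B)) ⟨hyV, hyB⟩
    obtain ⟨R, ⟨hR, hRA⟩, hzR⟩ := hzA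
    obtain ⟨S, ⟨hS, hSB⟩, hzS⟩ := hzB
    exact ⟨z, hzV, R ∩ S, ⟨hR.inter_aux hS, inter_subset_inter hRA hSB⟩, hzR, hzS⟩
  · right
    refine mem_interior.2 ⟨interior (closure (deltaInt A)) ∩ interior (deltaCl B), ?_,
      isOpen_interior.inter isOpen_interior, hW, h⟩
    rintro y ⟨hyW, hyB⟩
    rw [mem_deltaCl_aux]
    intro U hU hyU
    obtain ⟨z, ⟨hzU, hzB⟩, R, ⟨hR, hRA⟩, hzR⟩ := mem_closure_iff.1 (interior_subset hyW) _
      (hU.isOpen_aux.inter isOpen_interior) ⟨hyU, hyB⟩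
    obtain ⟨w, ⟨hwU, hwR⟩, hwB⟩ := (mem_deltaCl_aux B z).1 (interior_subset hzB) _
      (hU.inter_aux hR) ⟨hzU, hzR⟩
    exact ⟨w, hwU, hRA hwR, hwB⟩
end

section
/- Let X be a topological space and A a subset of X. Then A is a-locally closed if and only if A ∪ (X \ a-cl(A)) is a-open. -/
open Set Topology

theorem deltaInt_mono' {X : Type*} [TopologicalSpace X] {A B : Set X} (h : A ⊆ B) :
    deltaInt A ⊆ deltaInt B :=
  sUnion_subset_sUnion (fun _ hU => ⟨hU.1, hU.2.trans h⟩)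

theorem aOpen_sUnion' {X : Type*} [TopologicalSpace X] (S : Set (Set X))
    (h : ∀ U ∈ S, AOpen U) : AOpen (⋃₀ S) := by
  rintro x ⟨U, hU, hx⟩
  exact interior_mono (closure_mono (deltaInt_mono' (subset_sUnion_of_mem hU))) (h U hU hx)

theorem aOpen_union' {X : Type*} [TopologicalSpace X] {U V : Set X}
    (hU : AOpen U) (hV : AOpen V) : AOpen (U ∪ V) := by
  rw [← sUnion_pair]
  apply aOpen_sUnion'
  rintro W (rfl | rfl)
  · exact hU
  · exact hV

theorem aClosed_aCl' {X : Type*} [TopologicalSpace X] (A : Set X) : AClosed (aCl A) := by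
  unfold AClosed aCl
  rw [compl_sInter]
  apply aOpen_sUnion'
  rintro _ ⟨F, hF, rfl⟩
  exact hF.1

theorem subset_aCl' {X : Type*} [TopologicalSpace X] (A : Set X) : A ⊆ aCl A :=
  subset_sInter (fun _ hF => hF.2)

theorem aLocallyClosed_iff_union_compl_aCl_aOpen {X : Type*} [TopologicalSpace X]
    (A : Set X) : ALocallyClosed A ↔ AOpen (A ∪ (aCl A)ᶜ) := by
  constructor
  · rintro ⟨U, V, hU, hV, hA⟩
    have hAU : A ⊆ U := hA ▸ inter_subset_left
    have hcl : aCl A ⊆ V := sInter_subset_of_mem ⟨hV, hA ▸ inter_subset_right⟩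
    have key : A ∪ (aCl A)ᶜ = U ∪ (aCl A)ᶜ := by
      apply Subset.antisymm (union_subset_union_left _ hAU)
      rintro x (hx | hx)
      · by_cases hc : x ∈ aCl A
        · left
          rw [hA]
          exact ⟨hx, hcl hc⟩
        · exact Or.inr hc
      · exact Or.inr hx
    rw [key]
    exact aOpen_union' hU (aClosed_aCl' A)
  · intro h
    refine ⟨_, aCl A, h, aClosed_aCl' A, ?_⟩
    rw [union_inter_distrib_right, compl_inter_self, union_empty]
    exact (inter_eq_left.mpr (subset_aCl' A)).symm
end
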